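/- Let G and H be two commensurable finitely generated groups, i.e. there exist finite-index subgroups G' ≤ G and H' ≤ H with G' isomorphic to H'. Then M_SFT(G) = M_SFT(H) and M_sof(G) = M_sof(H). -/

import Mathlib

namespace MedvedevFormal

/-! ### Medvedev reducibility on Baire space -/

/-- The finite prefix of length `k` of a point of Baire space, as a list. -/
def pref (x : ℕ → ℕ) (k : ℕ) : List ℕ := (List.range k).map x

/-- Medvedev reducibility `m(P) ≤ m(Q)` between subsets of Baire space: some computable
monotone prefix-functional (i.e. a partial computable type-two functional), defined on all
of `Q`, maps every element of `Q` to an element of `P`. -/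
def BaireLE (P Q : Set (ℕ → ℕ)) : Prop :=
  ∃ φ : List ℕ → List ℕ, Computable φ ∧
    (∀ l₁ l₂ : List ℕ, l₁ <+: l₂ → φ l₁ <+: φ l₂) ∧
    ∀ x ∈ Q, ∃ y ∈ P, ∀ n : ℕ, ∃ k : ℕ, (φ (pref x k))[n]? = some (y n)

/-- Medvedev equivalence: `m(P) = m(Q)`. -/
def BaireEquiv (P Q : Set (ℕ → ℕ)) : Prop := BaireLE P Q ∧ BaireLE Q P

/-- A canonical representative of the join `m(P) ∨ m(Q)`. -/
def joinSet (P Q : Set (ℕ → ℕ)) : Set (ℕ → ℕ) :=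
  {x | (fun n => x (2 * n)) ∈ P ∧ (fun n => x (2 * n + 1)) ∈ Q}

/-- A canonical representative of the meet `m(P) ∧ m(Q)`. -/
def meetSet (P Q : Set (ℕ → ℕ)) : Set (ℕ → ℕ) :=
  {x | (x 0 = 0 ∧ (fun n => x (n + 1)) ∈ P) ∨ (x 0 = 1 ∧ (fun n => x (n + 1)) ∈ Q)}

/-- `P` has the zero Medvedev degree `0_M`: it contains a computable point. -/
def IsZeroDeg (P : Set (ℕ → ℕ)) : Prop := ∃ y ∈ P, Computable y

/-- The cylinder of a finite word in Baire space. -/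
def cylinder (l : List ℕ) : Set (ℕ → ℕ) :=
  {x | ∀ (i : ℕ) (h : i < l.length), x i = l[i]}

/-- Cantor space `{0,1}^ℕ` inside Baire space. -/
def cantorSpace : Set (ℕ → ℕ) := {x | ∀ n, x n ≤ 1}

/-- `P` is an effectively closed (`Π⁰₁`) subset of Cantor space: its complement within
Cantor space is the union of the cylinders of a computably enumerable sequence of words. -/
def IsPi01Cantor (P : Set (ℕ → ℕ)) : Prop :=
  ∃ f : ℕ → List ℕ, Computable f ∧ P = cantorSpace \ ⋃ n, cylinder (f n)

/-- The Medvedev degree of `P` is a `Π⁰₁` Medvedev degree. -/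
def IsPi01Deg (P : Set (ℕ → ℕ)) : Prop :=
  ∃ Q, IsPi01Cantor Q ∧ Q.Nonempty ∧ BaireEquiv P Q

/-- `P` realizes the maximal `Π⁰₁` Medvedev degree (the degree of the class of complete
consistent extensions of Peano arithmetic): it is a nonempty `Π⁰₁` subset of Cantor space
to which every nonempty `Π⁰₁` subset of Cantor space is Medvedev reducible. -/
def IsMaxPi01 (P : Set (ℕ → ℕ)) : Prop :=
  IsPi01Cantor P ∧ P.Nonempty ∧ ∀ Q, IsPi01Cantor Q → Q.Nonempty → BaireLE Q P

/-! ### Encoding of configuration spaces -/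

/-- The canonical encoding of a configuration `x : α → A` as a point of Baire space. -/
def confFun {α A : Type*} [Encodable α] [Encodable A] (x : α → A) : ℕ → ℕ :=
  fun n => Encodable.encode ((Encodable.decode (α := α) n).map x)

/-- The image of a set of configurations in Baire space, used to measure its
Medvedev degree. -/
def mSet {α A : Type*} [Encodable α] [Encodable A] (X : Set (α → A)) : Set (ℕ → ℕ) :=
  confFun '' X

/-- A configuration is computable if its Baire-space encoding is computable. -/
def ComputablePoint {α A : Type*} [Encodable α] [Encodable A] (x : α → A) : Prop :=
  Computable (confFun x)

/-- `m(X) ≤ m(Y)` for sets of configurations. -/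
def MedLE {α A β B : Type*} [Encodable α] [Encodable A] [Encodable β] [Encodable B]
    (X : Set (α → A)) (Y : Set (β → B)) : Prop :=
  BaireLE (mSet X) (mSet Y)

/-- `m(X) = m(Y)` for sets of configurations. -/
def MedEquiv {α A β B : Type*} [Encodable α] [Encodable A] [Encodable β] [Encodable B]
    (X : Set (α → A)) (Y : Set (β → B)) : Prop :=
  MedLE X Y ∧ MedLE Y X

/-! ### Subshifts -/

/-- The left shift action: `(g • x) h = x (g⁻¹ h)`. -/
def shift {G A : Type*} [Group G] (g : G) (x : G → A) : G → A := fun h => x (g⁻¹ * h)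

/-- The prodiscrete topology on `A^G`. -/
def prodiscrete (G A : Type*) : TopologicalSpace (G → A) :=
  @Pi.topologicalSpace G (fun _ => A) fun _ => ⊥

/-- A subshift: a shift-invariant subset of `A^G`, closed in the prodiscrete topology. -/
def IsSubshift {G A : Type*} [Group G] (X : Set (G → A)) : Prop :=
  (∀ x ∈ X, ∀ g : G, shift g x ∈ X) ∧ @IsClosed (G → A) (prodiscrete G A) X

/-- A pattern: a map `p : D → A` with `D ⊆ G` finite. -/
structure Pattern (G A : Type*) where
  dom : Finset G
  val : {g // g ∈ dom} → A

/-- The translate `g • x` agrees with the pattern `p` on its domain. -/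
def MatchesAt {G A : Type*} [Group G] (p : Pattern G A) (g : G) (x : G → A) : Prop :=
  ∀ h : {g' // g' ∈ p.dom}, shift g x h = p.val h

/-- A subshift of finite type: defined by a finite list of forbidden patterns. -/
def IsSFT {G A : Type*} [Group G] (X : Set (G → A)) : Prop :=
  ∃ F : List (Pattern G A), X = {x | ∀ p ∈ F, ∀ g : G, ¬MatchesAt p g x}

/-- A morphism between subshifts: a continuous shift-equivariant map from `X` to `Y`. -/
def IsMorphism {G A B : Type*} [Group G] (X : Set (G → A)) (Y : Set (G → B))
    (φ : (G → A) → (G → B)) : Prop :=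
  Set.MapsTo φ X Y ∧
    @ContinuousOn (G → A) (G → B) (prodiscrete G A) (prodiscrete G B) φ X ∧
    ∀ x ∈ X, ∀ g : G, φ (shift g x) = shift g (φ x)

/-- A sofic subshift: the image of an SFT (on some finite alphabet) under a topological
factor map. -/
def IsSofic {G A : Type*} [Group G] (X : Set (G → A)) : Prop :=
  ∃ (B : Type) (_ : Finite B) (Y : Set (G → B)) (φ : (G → B) → (G → A)),
    IsSFT Y ∧ IsMorphism Y X φ ∧ φ '' Y = X

/-! ### Finitely generated groups, covers and pullbacks -/

/-- `σ` enumerates a finite symmetric generating set of `G`. -/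
def IsSymmGen {G : Type*} [Group G] {k : ℕ} (σ : Fin k → G) : Prop :=
  Subgroup.closure (Set.range σ) = ⊤ ∧ ∀ i, (σ i)⁻¹ ∈ Set.range σ

/-- The canonical encoding of a free group via reduced words. -/
instance freeGroupEncodable {α : Type*} [DecidableEq α] [Encodable α] :
    Encodable (FreeGroup α) :=
  Encodable.ofLeftInjection FreeGroup.toWord (fun l => some (FreeGroup.mk l))
    fun _ => congrArg some FreeGroup.mk_toWord

/-- The canonical homomorphism from the free group determined by `σ`. -/
def cover {G : Type*} [Group G] {k : ℕ} (σ : Fin k → G) : FreeGroup (Fin k) →* G :=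
  FreeGroup.lift σ

/-- The pullback of a subshift along a group homomorphism. -/
def pullback {K G A : Type*} [Group K] [Group G] (ρ : K →* G) (X : Set (G → A)) :
    Set (K → A) :=
  (fun x => x ∘ ρ) '' X

/-- The group element represented by a word over the generators. -/
def wordVal {G : Type*} [Group G] {k : ℕ} (σ : Fin k → G) (w : List (Fin k × Bool)) : G :=
  cover σ (FreeGroup.mk w)

/-- `G` is recursively presented w.r.t. `σ`: its word problem is recursively enumerable. -/
def RecursivelyPresented {G : Type*} [Group G] {k : ℕ} (σ : Fin k → G) : Prop :=
  ∃ f : ℕ → Option (List (Fin k × Bool)), Computable f ∧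
    ∀ w : List (Fin k × Bool), (wordVal σ w = 1 ↔ ∃ n, f n = some w)

/-- The membership problem of the subgroup `H` in `G` is decidable w.r.t. `σ`. -/
def DecidableMembership {G : Type*} [Group G] {k : ℕ} (σ : Fin k → G)
    (H : Subgroup G) : Prop :=
  ∃ φ : List (Fin k × Bool) → Bool, Computable φ ∧
    ∀ w : List (Fin k × Bool), (φ w = true ↔ wordVal σ w ∈ H)

/-- `G` has decidable word problem w.r.t. `σ`. -/
def DecidableWordProblem {G : Type*} [Group G] {k : ℕ} (σ : Fin k → G) : Prop :=
  ∃ φ : List (Fin k × Bool) → Bool, Computable φ ∧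
    ∀ w : List (Fin k × Bool), (φ w = true ↔ wordVal σ w = 1)

/-- The set of configurations on the free group matching a coded pattern: a pattern is
coded as a list of pairs (code of a group element, code of a letter). -/
def codedCylinder {k : ℕ} {A : Type*} [Encodable A] (p : List (ℕ × ℕ)) :
    Set (FreeGroup (Fin k) → A) :=
  {x | ∀ q ∈ p, ∀ g : FreeGroup (Fin k),
    Encodable.encode g = q.1 → Encodable.encode (x g) = q.2}

/-- `X` is an effective subshift: the complement of its pullback to the free group is the
union of the cylinders of a computably enumerable sequence of finitely supported patterns. -/
def IsEffective {G : Type*} [Group G] {k : ℕ} (σ : Fin k → G) {A : Type*} [Encodable A]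
    (X : Set (G → A)) : Prop :=
  ∃ f : ℕ → List (ℕ × ℕ), Computable f ∧
    (pullback (cover σ) X)ᶜ = ⋃ n, codedCylinder (f n)

/-! ### Degree spectra -/

/-- The Medvedev degree of `P` belongs to `M_SFT(G)`: some nonempty `G`-SFT has the
Medvedev degree of `P`. -/
def IsSFTDeg {G : Type*} [Group G] {k : ℕ} (σ : Fin k → G) (P : Set (ℕ → ℕ)) : Prop :=
  ∃ (n : ℕ) (X : Set (G → Fin n)), IsSFT X ∧ X.Nonempty ∧
    BaireEquiv (mSet (pullback (cover σ) X)) P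

/-- The Medvedev degree of `P` belongs to `M_sof(G)`. -/
def IsSoficDeg {G : Type*} [Group G] {k : ℕ} (σ : Fin k → G) (P : Set (ℕ → ℕ)) : Prop :=
  ∃ (n : ℕ) (X : Set (G → Fin n)), IsSofic X ∧ X.Nonempty ∧
    BaireEquiv (mSet (pullback (cover σ) X)) P

/-- The Medvedev degree of `P` belongs to `M_eff(G)`. -/
def IsEffDeg {G : Type*} [Group G] {k : ℕ} (σ : Fin k → G) (P : Set (ℕ → ℕ)) : Prop :=
  ∃ (n : ℕ) (X : Set (G → Fin n)), IsSubshift X ∧ IsEffective σ X ∧ X.Nonempty ∧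
    BaireEquiv (mSet (pullback (cover σ) X)) P

/-! ### Word metrics and quasi-isometries -/

/-- The word length of `g` w.r.t. the (symmetric) generating map `σ`. -/
noncomputable def wordNorm {G : Type*} [Group G] {k : ℕ} (σ : Fin k → G) (g : G) : ℕ :=
  sInf {n | ∃ w : List (Fin k), w.length = n ∧ (w.map σ).prod = g}

/-- The word metric on `G` w.r.t. `σ`, as a real number. -/
noncomputable def wordDist {G : Type*} [Group G] {k : ℕ} (σ : Fin k → G) (g g' : G) : ℝ :=
  (wordNorm σ (g⁻¹ * g') : ℝ)

/-- `f : G → H` is a quasi-isometry w.r.t. the word metrics given by `σ` and `τ`. -/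
def IsQIGroups {G H : Type*} [Group G] [Group H] {k r : ℕ} (σ : Fin k → G)
    (τ : Fin r → H) (f : G → H) : Prop :=
  ∃ C : ℝ, 1 ≤ C ∧
    (∀ g g' : G, (1 / C) * wordDist σ g g' - C ≤ wordDist τ (f g) (f g') ∧
      wordDist τ (f g) (f g') ≤ C * wordDist σ g g' + C) ∧
    ∀ h : H, ∃ g : G, wordDist τ h (f g) ≤ C

/-- `f : G → Y` is a quasi-isometry from the group `G` (with word metric from `σ`) to the
metric space `Y`. -/
def IsQIToSpace {G : Type*} [Group G] {k : ℕ} (σ : Fin k → G) {Y : Type*}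
    [MetricSpace Y] (f : G → Y) : Prop :=
  ∃ C : ℝ, 1 ≤ C ∧
    (∀ g g' : G, (1 / C) * wordDist σ g g' - C ≤ dist (f g) (f g') ∧
      dist (f g) (f g') ≤ C * wordDist σ g g' + C) ∧
    ∀ y : Y, ∃ g : G, dist y (f g) ≤ C

/-- `f : G → H` is computable w.r.t. the generating maps `σ` and `τ`: some computable map
on words sends each word representing `g` to a word representing `f g`. -/
def ComputableMap {G H : Type*} [Group G] [Group H] {k r : ℕ} (σ : Fin k → G)
    (τ : Fin r → H) (f : G → H) : Prop :=
  ∃ φ : List (Fin k × Bool) → List (Fin r × Bool), Computable φ ∧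
    ∀ w : List (Fin k × Bool), wordVal τ (φ w) = f (wordVal σ w)

/-! ### Medvedev reductions between pulled back configuration spaces -/

theorem pref_prefix_pref (x : ℕ → ℕ) {k k' : ℕ} (h : k ≤ k') : pref x k <+: pref x k' := by
  obtain ⟨d, rfl⟩ := Nat.exists_eq_add_of_le h
  simp only [pref, List.range_add, List.map_append]
  exact List.prefix_append _ _

theorem pref_getElem? (x : ℕ → ℕ) {n k : ℕ} (h : n < k) : (pref x k)[n]? = some (x n) := by
  simp [pref, h]

theorem getElem?_of_isPrefix {α : Type*} {l l' : List α} (h : l <+: l') {n : ℕ} {a : α}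
    (ha : l[n]? = some a) : l'[n]? = some a := by
  obtain ⟨t, rfl⟩ := h
  rw [List.getElem?_append_left (List.getElem?_eq_some_iff.1 ha).1, ha]

theorem pref_prefix_of_getElem? {y : ℕ → ℕ} {l : List ℕ} {k : ℕ}
    (h : ∀ i < k, l[i]? = some (y i)) : pref y k <+: l := by
  rw [List.prefix_iff_getElem?]
  intro i hi
  have hi' : i < k := by simpa [pref] using hi
  rw [h i hi']
  simp [pref]

theorem BaireLE.trans {P Q R : Set (ℕ → ℕ)} (h₁ : BaireLE P Q) (h₂ : BaireLE Q R) :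
    BaireLE P R := by
  obtain ⟨φ, hφ, mφ, tφ⟩ := h₁
  obtain ⟨ψ, hψ, mψ, tψ⟩ := h₂
  refine ⟨fun l => φ (ψ l), hφ.comp hψ, fun _ _ h => mφ _ _ (mψ _ _ h), fun x hx => ?_⟩
  obtain ⟨y, hy, hxy⟩ := tψ x hx
  obtain ⟨z, hz, hyz⟩ := tφ y hy
  refine ⟨z, hz, fun n => ?_⟩
  obtain ⟨k, hk⟩ := hyz n
  choose K hK using hxy
  refine ⟨(Finset.range k).sup K, getElem?_of_isPrefix (mφ _ _ ?_) hk⟩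
  refine pref_prefix_of_getElem? fun i hi => ?_
  exact getElem?_of_isPrefix
    (mψ _ _ (pref_prefix_pref x (Finset.le_sup (Finset.mem_range.2 hi)))) (hK i)

theorem BaireEquiv.trans {P Q R : Set (ℕ → ℕ)} (h₁ : BaireEquiv P Q) (h₂ : BaireEquiv Q R) :
    BaireEquiv P R :=
  ⟨h₁.1.trans h₂.1, h₂.2.trans h₁.2⟩

theorem BaireLE.nonempty {P Q : Set (ℕ → ℕ)} (h : BaireLE P Q) (hQ : Q.Nonempty) :
    P.Nonempty := by
  obtain ⟨φ, -, -, t⟩ := h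
  obtain ⟨y, hy, -⟩ := t _ hQ.some_mem
  exact ⟨y, hy⟩

/-- The list of the values `v 0 l, v 1 l, …`, up to the first undefined one and at most
`N` of them. -/
def initialValues (v : ℕ → List ℕ → Option ℕ) (l : List ℕ) (N : ℕ) : List ℕ :=
  N.rec [] fun j acc => if acc.length = j then acc ++ (v j l).toList else acc

theorem initialValues_succ (v : ℕ → List ℕ → Option ℕ) (l : List ℕ) (N : ℕ) :
    initialValues v l (N + 1) = if (initialValues v l N).length = N then
      initialValues v l N ++ (v N l).toList else initialValues v l N :=
  rfl

theorem initialValues_length_le (v : ℕ → List ℕ → Option ℕ) (l : List ℕ) (N : ℕ) :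
    (initialValues v l N).length ≤ N := by
  induction N with
  | zero => simp [initialValues]
  | succ N ih =>
    rw [initialValues_succ]
    split_ifs with h
    · cases v N l <;> simp [h]
    · omega

theorem initialValues_prefix_succ (v : ℕ → List ℕ → Option ℕ) (l : List ℕ) (N : ℕ) :
    initialValues v l N <+: initialValues v l (N + 1) := by
  rw [initialValues_succ]
  split_ifs
  · exact List.prefix_append _ _
  · exact List.prefix_rfl

theorem initialValues_prefix_of_le (v : ℕ → List ℕ → Option ℕ) (l : List ℕ) {N M : ℕ}
    (h : N ≤ M) : initialValues v l N <+: initialValues v l M := by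
  induction M, h using Nat.le_induction with
  | base => exact List.prefix_rfl
  | succ M _ ih => exact ih.trans (initialValues_prefix_succ v l M)

theorem initialValues_mono {v : ℕ → List ℕ → Option ℕ}
    (hv : ∀ j l l' a, l <+: l' → v j l = some a → v j l' = some a) {l l' : List ℕ}
    (h : l <+: l') (N : ℕ) : initialValues v l N <+: initialValues v l' N := by
  induction N with
  | zero => exact List.prefix_rfl
  | succ N ih =>
    by_cases hN : (initialValues v l N).length = N
    · have e : initialValues v l N = initialValues v l' N :=
        ih.eq_of_length_le (by rw [hN]; exact initialValues_length_le v l' N)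
      rw [initialValues_succ, initialValues_succ, if_pos hN, ← e, if_pos hN,
        List.prefix_append_right_inj]
      cases hj : v N l with
      | none => simp
      | some a => rw [hv N l l' a h hj]
    · rw [initialValues_succ, if_neg hN]
      exact ih.trans (initialValues_prefix_succ v l' N)

theorem initialValues_eq_pref {v : ℕ → List ℕ → Option ℕ} {l : List ℕ} {y : ℕ → ℕ} {N : ℕ}
    (h : ∀ j < N, v j l = some (y j)) : initialValues v l N = pref y N := by
  induction N with
  | zero => rfl
  | succ N ih =>
    rw [initialValues_succ, ih fun j hj => h j (by omega), h N (by omega)]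
    simp [pref, List.range_succ]

/-- A computable family of monotone partial functionals, one for each coordinate of the
output, defines a Medvedev reduction. -/
theorem baireLE_of_values {P Q : Set (ℕ → ℕ)} (v : ℕ → List ℕ → Option ℕ)
    (hc : Primrec₂ v) (hv : ∀ j l l' a, l <+: l' → v j l = some a → v j l' = some a)
    (h : ∀ x ∈ Q, ∃ y ∈ P, ∀ n, ∃ k, v n (pref x k) = some (y n)) : BaireLE P Q := by
  refine ⟨fun l => initialValues v l l.length, ?_, fun l l' hl => ?_, fun x hx => ?_⟩
  · refine Primrec.to_comp ?_
    refine Primrec.nat_rec' (h := fun l p => if p.2.length = p.1 then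
      p.2 ++ (v p.1 l).toList else p.2) Primrec.list_length (Primrec.const []) ?_
    have hp : Primrec fun q : List ℕ × ℕ × List ℕ => q.2.1 := Primrec.fst.comp Primrec.snd
    have hl : Primrec fun q : List ℕ × ℕ × List ℕ => q.2.2 := Primrec.snd.comp Primrec.snd
    refine Primrec.ite (Primrec.eq.comp (Primrec.list_length.comp hl) hp)
      (Primrec.list_append.comp hl ?_) hl
    refine (Primrec.option_casesOn (hc.comp hp Primrec.fst) (Primrec.const [])
      (Primrec.list_cons.comp Primrec.snd (Primrec.const [])).to₂).of_eq fun q => ?_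
    cases v q.2.1 q.1 <;> rfl
  · exact (initialValues_mono hv hl _).trans (initialValues_prefix_of_le v l' hl.length_le)
  · obtain ⟨y, hy, hxy⟩ := h x hx
    refine ⟨y, hy, fun n => ?_⟩
    choose K hK using hxy
    let k := max (n + 1) ((Finset.range (n + 1)).sup K)
    have hk : initialValues v (pref x k) (n + 1) = pref y (n + 1) :=
      initialValues_eq_pref fun j hj => hv j _ _ _ (pref_prefix_pref x
        ((Finset.le_sup (Finset.mem_range.2 hj)).trans (le_max_right _ _))) (hK j)
    refine ⟨k, getElem?_of_isPrefix (initialValues_prefix_of_le v _ (N := n + 1) ?_) ?_⟩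
    · simp [pref, k]
    · rw [hk, pref_getElem? y n.lt_succ_self]

theorem confFun_comp_cover {G A : Type*} [Group G] [Encodable A] {k : ℕ} (σ : Fin k → G)
    (x : G → A) (n : ℕ) : confFun (x ∘ cover σ) n =
      Encodable.encode ((Encodable.decode (α := List (Fin k × Bool)) n).map
        fun w => x (wordVal σ w)) := by
  unfold confFun
  congr 1
  change Option.map _ ((Encodable.decode n).bind _) = _
  cases (Encodable.decode n : Option (List (Fin k × Bool))) <;> rfl

/-- If each value `y (wordVal τ w)` is determined by a computable state and by finitely many
values of `x` at computable words, then there is a Medvedev reduction. -/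
theorem baireLE_of_queries {G K : Type*} [Group G] [Group K] {k l m n N r : ℕ}
    {σ : Fin k → G} {τ : Fin l → K} {X : Set (G → Fin n)} {Y : Set (K → Fin N)}
    (q : Fin m → List (Fin l × Bool) → List (Fin k × Bool)) (hq : ∀ j, Primrec (q j))
    (s : List (Fin l × Bool) → Fin r) (hs : Primrec s)
    (d : Fin r → (Fin m → Fin n) → Fin N)
    (h : ∀ x ∈ X, ∃ y ∈ Y, ∀ w, y (wordVal τ w) = d (s w) fun j => x (wordVal σ (q j w))) :
    BaireLE (mSet (pullback (cover τ) Y)) (mSet (pullback (cover σ) X)) := by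
  classical
  let D : Fin r × (Fin m → Option (Option (Fin n))) → Option ℕ := fun p =>
    if hp : ∃ f : Fin m → Fin n, p.2 = fun j => some (some (f j)) then
      some (Encodable.encode (some (d p.1 hp.choose))) else none
  have hD : ∀ i (f : Fin m → Fin n),
      D (i, fun j => some (some (f j))) = some (Encodable.encode (some (d i f))) := by
    intro i f
    have hp : ∃ f' : Fin m → Fin n,
        (fun j => some (some (f j))) = fun j => some (some (f' j)) := ⟨f, rfl⟩
    have e : hp.choose = f := by
      funext j
      simpa using (congrFun hp.choose_spec j).symm
    simp only [D]
    rw [dif_pos hp, e]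
  let u : List ℕ → List (Fin l × Bool) → Fin m → Option (Option (Fin n)) := fun L w j =>
    (L[Encodable.encode (q j w)]?).bind fun c => Encodable.decode (α := Option (Fin n)) c
  let v : ℕ → List ℕ → Option ℕ := fun i L =>
    Option.casesOn (Encodable.decode (α := List (Fin l × Bool)) i)
      (some 0) fun w => D (s w, u L w)
  refine baireLE_of_values v ?_ ?_ ?_
  · refine Primrec.option_casesOn (Primrec.decode.comp Primrec.fst) (Primrec.const _) ?_
    refine (Primrec.dom_finite D).comp (Primrec.pair (hs.comp Primrec.snd) ?_)
    refine Primrec.fin_curry.2 (Primrec₂.swap (Primrec.fin_curry₁.2 fun j => ?_))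
    exact Primrec.option_bind (Primrec.list_getElem?.comp (Primrec.snd.comp Primrec.fst)
      (Primrec.encode.comp ((hq j).comp Primrec.snd)))
      (Primrec.decode.comp Primrec.snd).to₂
  · intro i L L' a hL
    simp only [v]
    cases (Encodable.decode i : Option (List (Fin l × Bool))) with
    | none => exact id
    | some w =>
      intro ha
      have hp : ∃ f : Fin m → Fin n, u L w = fun j => some (some (f j)) := by
        by_contra hp
        simp [D, dif_neg hp] at ha
      obtain ⟨f, hf⟩ := hp
      have hf' : u L' w = u L w := by
        funext j
        have hj := congrFun hf j
        rw [hj]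
        obtain ⟨c, hc, hc'⟩ := Option.bind_eq_some_iff.1 hj
        exact Option.bind_eq_some_iff.2 ⟨c, getElem?_of_isPrefix hL hc, hc'⟩
      change D (s w, u L' w) = some a
      rw [hf']
      exact ha
  · rintro _ ⟨_, ⟨x, hx, rfl⟩, rfl⟩
    obtain ⟨y, hy, hxy⟩ := h x hx
    refine ⟨_, ⟨_, ⟨y, hy, rfl⟩, rfl⟩, fun i => ?_⟩
    simp only [v, confFun_comp_cover]
    cases (Encodable.decode i : Option (List (Fin l × Bool))) with
    | none => exact ⟨0, rfl⟩
    | some w =>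
      refine ⟨(Finset.univ.sup fun j => Encodable.encode (q j w)) + 1, ?_⟩
      change D (s w, _) = _
      rw [Option.map_some, hxy w, ← hD]
      congr 2
      funext j
      simp only [u]
      rw [pref_getElem? _ (Nat.lt_succ_of_le
        (Finset.le_sup (f := fun j => Encodable.encode (q j w)) (Finset.mem_univ j)))]
      simp [confFun_comp_cover]

/-! ### Rewriting of words along maps between groups -/

section Words

variable {G K : Type*} [Group G] [Group K] {k l : ℕ}

theorem wordVal_append (σ : Fin k → G) (w w' : List (Fin k × Bool)) :
    wordVal σ (w ++ w') = wordVal σ w * wordVal σ w' := by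
  simp only [wordVal, ← FreeGroup.mul_mk, map_mul]

theorem wordVal_invRev (σ : Fin k → G) (w : List (Fin k × Bool)) :
    wordVal σ (FreeGroup.invRev w) = (wordVal σ w)⁻¹ := by
  simp only [wordVal, ← FreeGroup.inv_mk, map_inv]

theorem wordVal_surjective {σ : Fin k → G} (hσ : Subgroup.closure (Set.range σ) = ⊤) :
    Function.Surjective (wordVal σ) := by
  intro g
  have hg : g ∈ (FreeGroup.lift σ).range := by
    rw [FreeGroup.range_lift_eq_closure, hσ]
    exact Subgroup.mem_top g
  obtain ⟨f, rfl⟩ := hg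
  exact ⟨f.toWord, by simp [wordVal, cover, FreeGroup.mk_toWord]⟩

theorem primrec_invRev : Primrec (FreeGroup.invRev : List (Fin k × Bool) → _) :=
  Primrec.list_reverse.comp (Primrec.list_map Primrec.id
    ((Primrec.dom_finite fun p : Fin k × Bool => (p.1, !p.2)).comp Primrec.snd).to₂)

/-- A relation between elements of `G` and elements of `K` with a finite state that can be
updated along right multiplication in `G` is realized by a computable map on words. -/
theorem exists_primrec_rewriting {r : ℕ} (σ : Fin k → G) {τ : Fin l → K}
    (hτ : Subgroup.closure (Set.range τ) = ⊤) (R : G → K → Fin r → Prop)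
    (h₁ : ∃ u s, R 1 u s)
    (hR : ∀ c s, ∃ κ s', ∀ g u, R g u s → R (g * c) (u * κ) s') :
    ∃ (q : List (Fin k × Bool) → List (Fin l × Bool)) (st : List (Fin k × Bool) → Fin r),
      Primrec q ∧ Primrec st ∧ ∀ w, R (wordVal σ w) (wordVal τ (q w)) (st w) := by
  obtain ⟨u₀, s₀, h₁⟩ := h₁
  obtain ⟨w₀, rfl⟩ := wordVal_surjective hτ u₀
  choose κ δ hκ using hR
  choose W hW using fun c s => wordVal_surjective hτ (κ c s)
  let step : List (Fin l × Bool) × Fin r → Fin k × Bool → List (Fin l × Bool) × Fin r :=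
    fun p c => (p.1 ++ W (wordVal σ [c]) p.2, δ (wordVal σ [c]) p.2)
  let run : List (Fin k × Bool) → List (Fin l × Bool) × Fin r :=
    fun w => w.foldl step (w₀, s₀)
  have hrun : Primrec run := by
    refine Primrec.list_foldl (h := fun _ p => step p.1 p.2) Primrec.id (Primrec.const _) ?_
    have hp : Primrec fun p : List (Fin k × Bool) × (List (Fin l × Bool) × Fin r) ×
        (Fin k × Bool) => (p.2.2, p.2.1.2) :=
      Primrec.pair (Primrec.snd.comp Primrec.snd)
        (Primrec.snd.comp (Primrec.fst.comp Primrec.snd))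
    exact Primrec.pair
      (Primrec.list_append.comp (Primrec.fst.comp (Primrec.fst.comp Primrec.snd))
        ((Primrec.dom_finite fun p : (Fin k × Bool) × Fin r =>
          W (wordVal σ [p.1]) p.2).comp hp))
      ((Primrec.dom_finite fun p : (Fin k × Bool) × Fin r =>
          δ (wordVal σ [p.1]) p.2).comp hp)
  refine ⟨fun w => (run w).1, fun w => (run w).2, Primrec.fst.comp hrun,
    Primrec.snd.comp hrun, fun w => ?_⟩
  induction w using List.reverseRecOn with
  | nil =>
    have : wordVal σ [] = 1 := by simp [wordVal, FreeGroup.one_eq_mk.symm]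
    rw [this]
    exact h₁
  | append_singleton w c ih =>
    have e : run (w ++ [c]) = step (run w) c := by simp [run]
    simp only [e, step, wordVal_append, hW]
    exact hκ _ _ _ _ ih

end Words

/-! ### Transversals of subgroups of finite index -/

theorem exists_transversal {G K : Type*} [Group G] [Group K] (ι : K →* G)
    (hι : Function.Injective ι) [ι.range.FiniteIndex] :
    ∃ (m : ℕ) (t : Fin m → G), Function.Bijective fun p : K × Fin m => ι p.1 * t p.2 := by
  obtain ⟨m, ⟨e⟩⟩ := Finite.exists_equiv_fin (G ⧸ ι.range)
  let out : Fin m → G := fun i => (e.symm i).out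
  have hout : ∀ i, ((out i : G) : G ⧸ ι.range) = e.symm i := fun i => Quotient.out_eq' _
  refine ⟨m, fun i => (out i)⁻¹, ?_, fun g => ?_⟩
  · rintro ⟨a, i⟩ ⟨b, j⟩ hab
    have h : out i * ι a⁻¹ = out j * ι b⁻¹ := by
      simpa using congrArg (fun g => g⁻¹) hab
    have hij : i = j := by
      apply e.symm.injective
      rw [← hout, ← hout, ← QuotientGroup.mk_mul_of_mem (out i) (⟨a⁻¹, rfl⟩ : ι a⁻¹ ∈ ι.range),
        h, QuotientGroup.mk_mul_of_mem _ (⟨b⁻¹, rfl⟩ : ι b⁻¹ ∈ ι.range)]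
    subst hij
    exact Prod.ext (inv_injective (hι (mul_left_cancel h))) rfl
  · have h : ((out (e ↑g⁻¹) : G) : G ⧸ ι.range) = (g⁻¹ : G) := by simp [hout]
    obtain ⟨a, ha⟩ := QuotientGroup.eq.1 h
    refine ⟨(a⁻¹, e ↑g⁻¹), ?_⟩
    simp [ha]

/-! ### Subshifts of finite type as locally defined sets -/

section Local

variable {G A : Type*} [Group G]

theorem IsSFT.exists_local {X : Set (G → A)} (hX : IsSFT X) :
    ∃ (D : Finset G) (p : (G → A) → Prop), (∀ x y, (∀ d ∈ D, x d = y d) → p x → p y) ∧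
      X = {x | ∀ g : G, p fun h => x (g * h)} := by
  classical
  obtain ⟨F, rfl⟩ := hX
  refine ⟨F.toFinset.biUnion Pattern.dom, fun x => ∀ q ∈ F, ¬MatchesAt q 1 x, ?_, ?_⟩
  · intro x y hxy hx q hq hy
    refine hx q hq fun h => ?_
    rw [← hy h]
    simpa [shift] using hxy h (Finset.mem_biUnion.2 ⟨q, List.mem_toFinset.2 hq, h.2⟩)
  · ext x
    refine ⟨fun hx g q hq hm => hx q hq g⁻¹ fun h => ?_,
      fun hx q hq g hm => hx g⁻¹ q hq fun h => ?_⟩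
    · simpa [shift] using hm h
    · simpa [shift] using hm h

theorem isSFT_of_local [Finite A] (D : Finset G) (p : (G → A) → Prop)
    (hp : ∀ x y, (∀ d ∈ D, x d = y d) → p x → p y) :
    IsSFT {x : G → A | ∀ g : G, p fun h => x (g * h)} := by
  classical
  obtain ⟨L, -, hL⟩ := Finite.exists_univ_list ({g // g ∈ D} → A)
  refine ⟨(L.filter fun f => ∀ x : G → A, (∀ d : {g // g ∈ D}, x d = f d) → ¬p x).map
    fun f => ⟨D, f⟩, ?_⟩
  ext x
  simp only [Set.mem_ofPred_eq, List.mem_map, List.mem_filter, decide_eq_true_eq]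
  constructor
  · rintro hx _ ⟨f, ⟨-, hf⟩, rfl⟩ g hm
    exact hf _ hm (hx g⁻¹)
  · intro hx g
    by_contra hg
    refine hx ⟨D, fun d => x (g * d)⟩ ⟨_, ⟨hL _, fun y hy hpy => hg ?_⟩, rfl⟩ g⁻¹ fun h => ?_
    · exact hp _ _ (fun d hd => hy ⟨d, hd⟩) hpy
    · simp [shift]

end Local

theorem IsSFT.shift_mem {G A : Type*} [Group G] {X : Set (G → A)} (hX : IsSFT X) {x : G → A}
    (hx : x ∈ X) (g : G) : shift g x ∈ X := by
  obtain ⟨F, rfl⟩ := hX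
  intro q hq h hm
  refine hx q hq (h * g) fun d => ?_
  simpa [shift, mul_assoc] using hm d

/-! ### Recoding a subshift on a group as a subshift on a subgroup of finite index -/

section Block

variable {G K A C : Type*} {m : ℕ}

/-- The bijection between configurations on `K` whose letters are blocks of letters of `A`
indexed by a transversal, and configurations on `G` with letters in `A`. -/
def unblock (E : K × Fin m ≃ G) (c : C ≃ (Fin m → A)) : (K → C) ≃ (G → A) where
  toFun y g := c (y (E.symm g).1) (E.symm g).2
  invFun x a := c.symm fun i => x (E (a, i))
  left_inv y := by ext; simp
  right_inv x := by ext; simp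

theorem continuous_unblock (E : K × Fin m ≃ G) (c : C ≃ (Fin m → A)) :
    @Continuous _ _ (prodiscrete K C) (prodiscrete G A) (unblock E c) := by
  let : TopologicalSpace A := ⊥
  let : TopologicalSpace C := ⊥
  have : DiscreteTopology C := ⟨rfl⟩
  change Continuous (unblock E c : (K → C) → (G → A))
  exact continuous_pi fun g => (continuous_of_discreteTopology
    (f := fun b => c b (E.symm g).2)).comp (continuous_apply (E.symm g).1)

theorem continuous_unblock_symm (E : K × Fin m ≃ G) (c : C ≃ (Fin m → A)) :
    @Continuous _ _ (prodiscrete G A) (prodiscrete K C) (unblock E c).symm := by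
  let : TopologicalSpace A := ⊥
  let : TopologicalSpace C := ⊥
  have : DiscreteTopology A := ⟨rfl⟩
  change Continuous ((unblock E c).symm : (G → A) → (K → C))
  exact continuous_pi fun a => (continuous_of_discreteTopology (f := c.symm)).comp
    (continuous_pi fun i => continuous_apply (E (a, i)))

variable [Group G] [Group K] {ι : K →* G} {t : Fin m → G}

theorem transversal_symm_mul {E : K × Fin m ≃ G} (hE : ∀ a i, E (a, i) = ι a * t i) (a : K)
    (g : G) : E.symm (ι a * g) = (a * (E.symm g).1, (E.symm g).2) := by
  rw [Equiv.symm_apply_eq, hE, map_mul, mul_assoc, ← hE, Prod.mk.eta, Equiv.apply_symm_apply]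

theorem unblock_mul {E : K × Fin m ≃ G} (hE : ∀ a i, E (a, i) = ι a * t i)
    (c : C ≃ (Fin m → A)) (y : K → C) (a : K) :
    unblock E c (fun h => y (a * h)) = fun g => unblock E c y (ι a * g) := by
  ext g
  simp [unblock, transversal_symm_mul hE]

theorem unblock_shift {E : K × Fin m ≃ G} (hE : ∀ a i, E (a, i) = ι a * t i)
    (c : C ≃ (Fin m → A)) (y : K → C) (a : K) :
    unblock E c (shift a y) = shift (ι a) (unblock E c y) := by
  unfold shift
  rw [unblock_mul hE, map_inv]

theorem unblock_symm_shift {E : K × Fin m ≃ G} (hE : ∀ a i, E (a, i) = ι a * t i)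
    (c : C ≃ (Fin m → A)) (x : G → A) (a : K) :
    (unblock E c).symm (shift (ι a) x) = shift a ((unblock E c).symm x) := by
  rw [Equiv.symm_apply_eq, unblock_shift hE, Equiv.apply_symm_apply]

theorem IsSFT.preimage_unblock [Finite C] {E : K × Fin m ≃ G}
    (hE : ∀ a i, E (a, i) = ι a * t i) (c : C ≃ (Fin m → A)) {X : Set (G → A)}
    (hX : IsSFT X) : IsSFT (unblock E c ⁻¹' X) := by
  classical
  obtain ⟨D, p, hp, rfl⟩ := hX.exists_local
  convert isSFT_of_local
    (Finset.univ.biUnion fun i => D.image fun d => (E.symm (t i * d)).1)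
    (fun y : K → C => ∀ i, p fun g => unblock E c y (t i * g)) ?_ using 1
  · ext y
    simp only [Set.mem_preimage, Set.mem_ofPred_eq]
    constructor
    · intro h a i
      simpa [unblock_mul hE, mul_assoc] using h (ι a * t i)
    · intro h g
      obtain ⟨⟨a, i⟩, rfl⟩ := E.surjective g
      simpa [unblock_mul hE, mul_assoc, hE] using h a i
  · intro y z hyz hy i
    refine hp _ _ (fun d hd => ?_) (hy i)
    have h := hyz (E.symm (t i * d)).1 (Finset.mem_biUnion.2
      ⟨i, Finset.mem_univ i, Finset.mem_image_of_mem _ hd⟩)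
    simp [unblock, h]

theorem IsSofic.preimage_unblock {E : K × Fin m ≃ G}
    (hE : ∀ a i, E (a, i) = ι a * t i) (c : C ≃ (Fin m → A)) {X : Set (G → A)}
    (hX : IsSofic X) : IsSofic (unblock E c ⁻¹' X) := by
  obtain ⟨B, _, Z, φ, hZ, ⟨hm, hc, hs⟩, rfl⟩ := hX
  let b : (Fin m → B) ≃ (Fin m → B) := Equiv.refl _
  refine ⟨Fin m → B, inferInstance, unblock E b ⁻¹' Z,
    fun z => (unblock E c).symm (φ (unblock E b z)), hZ.preimage_unblock hE b,
    ⟨fun z hz => ?_, ?_, fun z hz a => ?_⟩, ?_⟩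
  · simpa using hm hz
  · let := prodiscrete G A
    let := prodiscrete G B
    let := prodiscrete K C
    let := prodiscrete K (Fin m → B)
    exact (continuous_unblock_symm E c).comp_continuousOn
      (hc.comp (continuous_unblock E b).continuousOn fun _ h => h)
  · change (unblock E c).symm (φ (unblock E b (shift a z))) = _
    rw [unblock_shift hE, hs _ hz, unblock_symm_shift hE]
  · ext y
    constructor
    · rintro ⟨z, hz, rfl⟩
      exact ⟨_, hz, by simp⟩
    · rintro ⟨z, hz, h⟩
      exact ⟨(unblock E b).symm z, by simpa using hz, by simp [h]⟩

end Block

/-! ### Extending a subshift on a subgroup of finite index to the whole group -/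

section Cosetwise

variable {G K A : Type*} [Group G] [Group K] {m : ℕ} {ι : K →* G} {t : Fin m → G}

/-- The configurations on `G` whose restriction to every left coset of the range of `ι`
belongs to `Y`. -/
def cosetwise (ι : K →* G) (Y : Set (K → A)) : Set (G → A) :=
  {x | ∀ g : G, (fun a => x (g * ι a)) ∈ Y}

/-- The configuration on `G` made of one configuration on each left coset. -/
def glue (E : K × Fin m ≃ G) (y : Fin m → K → A) : G → A :=
  fun g => y (E.symm g⁻¹).2 (E.symm g⁻¹).1⁻¹

theorem glue_mul {E : K × Fin m ≃ G} (hE : ∀ a i, E (a, i) = ι a * t i)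
    (y : Fin m → K → A) (g : G) :
    (fun a => glue E y (g * ι a)) = shift (E.symm g⁻¹).1 (y (E.symm g⁻¹).2) := by
  ext a
  have h : (g * ι a)⁻¹ = ι a⁻¹ * g⁻¹ := by simp
  simp [glue, shift, h, transversal_symm_mul hE, -mul_inv_rev, -map_inv]
  simp

theorem IsSFT.cosetwise [Finite A] {Y : Set (K → A)} (hY : IsSFT Y) :
    IsSFT (cosetwise ι Y) := by
  classical
  obtain ⟨D, p, hp, rfl⟩ := hY.exists_local
  convert isSFT_of_local (D.image ι) (fun x : G → A => p fun a => x (ι a)) ?_ using 1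
  · ext x
    simp only [MedvedevFormal.cosetwise, Set.mem_ofPred_eq]
    constructor
    · intro h g
      simpa using h g 1
    · intro h g a
      simpa [mul_assoc] using h (g * ι a)
  · exact fun x y hxy hx => hp _ _ (fun d hd => hxy _ (Finset.mem_image_of_mem _ hd)) hx

theorem IsSofic.cosetwise {E : K × Fin m ≃ G} (hE : ∀ a i, E (a, i) = ι a * t i)
    {Y : Set (K → A)} (hY : IsSofic Y) : IsSofic (cosetwise ι Y) := by
  obtain ⟨B, _, Z, φ, hZ, ⟨hm, hc, hs⟩, rfl⟩ := hY
  let Φ : (G → B) → (G → A) := fun z g => φ (fun a => z (g * ι a)) 1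
  have hΦ : ∀ z ∈ MedvedevFormal.cosetwise ι Z, ∀ g,
      (fun a => Φ z (g * ι a)) = φ fun a => z (g * ι a) := by
    intro z hz g
    ext a
    have e : (fun b => z (g * ι a * ι b)) = shift a⁻¹ fun b => z (g * ι b) := by
      ext b
      simp [shift, mul_assoc]
    simp only [Φ]
    rw [e, hs _ (hz g)]
    simp [shift]
  have hm' : Set.MapsTo Φ (MedvedevFormal.cosetwise ι Z)
      (MedvedevFormal.cosetwise ι (φ '' Z)) := fun z hz g => by
    rw [hΦ z hz g]
    exact Set.mem_image_of_mem φ (hz g)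
  refine ⟨B, inferInstance, MedvedevFormal.cosetwise ι Z, Φ, hZ.cosetwise,
    ⟨hm', ?_, fun z hz g => ?_⟩, hm'.image_subset.antisymm fun x hx => ?_⟩
  · let : TopologicalSpace A := ⊥
    let : TopologicalSpace B := ⊥
    change ContinuousOn Φ _
    change ContinuousOn φ _ at hc
    refine continuousOn_pi.2 fun g => ?_
    exact (continuous_apply (1 : K)).comp_continuousOn (hc.comp
      (continuous_pi fun a => continuous_apply (g * ι a)).continuousOn fun z hz => hz g)
  · ext h
    simp [Φ, shift, mul_assoc]
  · choose y hy hyx using fun i => hx (t i)⁻¹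
    refine ⟨glue E y, fun g => ?_, ?_⟩
    · rw [glue_mul hE]
      exact hZ.shift_mem (hy _) _
    · ext g
      simp only [Φ]
      rw [glue_mul hE, hs _ (hy _), hyx]
      have h := hE (E.symm g⁻¹).1 (E.symm g⁻¹).2
      rw [Prod.mk.eta, Equiv.apply_symm_apply] at h
      simp only [shift]
      congr 1
      rw [mul_one, map_inv ι, ← mul_inv_rev, ← h, inv_inv]

end Cosetwise

/-! ### Invariance of the degree spectra -/

section Degrees

variable {G K : Type*} [Group G] [Group K] {k l m : ℕ} {ι : K →* G} {t : Fin m → G}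
  {σ : Fin k → G} {τ : Fin l → K}

theorem exists_primrec_substitution (ι : K →* G) (τ : Fin l → K)
    (hσ : Subgroup.closure (Set.range σ) = ⊤) :
    ∃ q : List (Fin l × Bool) → List (Fin k × Bool), Primrec q ∧
      ∀ w, wordVal σ (q w) = ι (wordVal τ w) := by
  obtain ⟨q, -, hq, -, h⟩ := exists_primrec_rewriting (r := 1) τ hσ
    (fun a g _ => g = ι a) ⟨1, 0, (map_one ι).symm⟩
    fun c _ => ⟨ι c, 0, fun a g h => by rw [h, map_mul]⟩
  exact ⟨q, hq, h⟩

theorem exists_primrec_coset_rewriting {E : K × Fin m ≃ G}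
    (hE : ∀ a i, E (a, i) = ι a * t i) (σ : Fin k → G)
    (hτ : Subgroup.closure (Set.range τ) = ⊤) :
    ∃ (q : List (Fin k × Bool) → List (Fin l × Bool)) (s : List (Fin k × Bool) → Fin m),
      Primrec q ∧ Primrec s ∧ ∀ w, E.symm (wordVal σ w) = (wordVal τ (q w), s w) := by
  refine exists_primrec_rewriting σ hτ (fun g a i => E.symm g = (a, i)) ⟨_, _, rfl⟩
    fun c i => ⟨(E.symm (t i * c)).1, (E.symm (t i * c)).2, fun g a h => ?_⟩
  rw [Equiv.symm_apply_eq] at h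
  rw [h, hE, mul_assoc, transversal_symm_mul hE]

theorem baireEquiv_preimage_unblock {E : K × Fin m ≃ G}
    (hE : ∀ a i, E (a, i) = ι a * t i) (hσ : Subgroup.closure (Set.range σ) = ⊤)
    (hτ : Subgroup.closure (Set.range τ) = ⊤) {n N : ℕ} (c : Fin N ≃ (Fin m → Fin n))
    (X : Set (G → Fin n)) :
    BaireEquiv (mSet (pullback (cover τ) (unblock E c ⁻¹' X)))
      (mSet (pullback (cover σ) X)) := by
  constructor
  · obtain ⟨q, hq, h⟩ := exists_primrec_substitution ι τ hσ
    choose T hT using fun i => wordVal_surjective hσ (t i)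
    refine baireLE_of_queries (r := 1) (fun i w => q w ++ T i)
      (fun i => Primrec.list_append.comp hq (Primrec.const _)) (fun _ => 0) (Primrec.const _)
      (fun _ f => c.symm f) fun x hx =>
        ⟨(unblock E c).symm x, by simpa using hx, fun w => ?_⟩
    simp [unblock, wordVal_append, h, hT, hE]
  · obtain ⟨q, s, hq, hs, h⟩ := exists_primrec_coset_rewriting hE σ hτ
    refine baireLE_of_queries (m := 1) (fun _ => q) (fun _ => hq) s hs
      (fun i f => c (f 0) i) fun y hy => ⟨unblock E c y, hy, fun w => ?_⟩
    simp [unblock, h]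

theorem baireEquiv_cosetwise {E : K × Fin m ≃ G}
    (hE : ∀ a i, E (a, i) = ι a * t i) (hσ : Subgroup.closure (Set.range σ) = ⊤)
    (hτ : Subgroup.closure (Set.range τ) = ⊤) {n : ℕ} {Y : Set (K → Fin n)}
    (hY : ∀ y ∈ Y, ∀ a, shift a y ∈ Y) :
    BaireEquiv (mSet (pullback (cover σ) (cosetwise ι Y)))
      (mSet (pullback (cover τ) Y)) := by
  constructor
  · obtain ⟨q, _, hq, -, h⟩ := exists_primrec_coset_rewriting hE σ hτ
    refine baireLE_of_queries (m := 1) (r := 1)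
      (fun _ w => FreeGroup.invRev (q (FreeGroup.invRev w)))
      (fun _ => primrec_invRev.comp (hq.comp primrec_invRev)) (fun _ => 0) (Primrec.const _)
      (fun _ f => f 0) fun y hy => ⟨glue E fun _ => y, fun g => ?_, fun w => ?_⟩
    · rw [glue_mul hE]
      exact hY y hy _
    · simp only [glue, ← wordVal_invRev, h]
  · obtain ⟨q, hq, h⟩ := exists_primrec_substitution ι τ hσ
    refine baireLE_of_queries (m := 1) (r := 1) (fun _ => q) (fun _ => hq) (fun _ => 0)
      (Primrec.const _) (fun _ f => f 0) fun x hx => ⟨fun a => x (ι a), ?_, fun w => ?_⟩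
    · simpa using hx 1
    · simp [h]

theorem nonempty_of_mSet_pullback {n : ℕ} {X : Set (G → Fin n)}
    (h : (mSet (pullback (cover σ) X)).Nonempty) : X.Nonempty :=
  h.of_image.of_image

theorem nonempty_mSet_pullback {n : ℕ} {X : Set (G → Fin n)} (h : X.Nonempty) :
    (mSet (pullback (cover σ) X)).Nonempty :=
  (h.image _).image _

theorem IsSofic.shift_mem {A : Type*} {X : Set (G → A)} (hX : IsSofic X) {x : G → A}
    (hx : x ∈ X) (g : G) : shift g x ∈ X := by
  obtain ⟨B, _, Z, φ, hZ, ⟨-, -, hs⟩, rfl⟩ := hX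
  obtain ⟨z, hz, rfl⟩ := hx
  exact ⟨shift g z, hZ.shift_mem hz g, hs z hz g⟩

/-- The degree spectra of a finitely generated group and of a subgroup of finite index
coincide. -/
theorem isSFTDeg_iff_and_isSoficDeg_iff (ι : K →* G) (hι : Function.Injective ι)
    [ι.range.FiniteIndex] (hσ : Subgroup.closure (Set.range σ) = ⊤)
    (hτ : Subgroup.closure (Set.range τ) = ⊤) (P : Set (ℕ → ℕ)) :
    (IsSFTDeg σ P ↔ IsSFTDeg τ P) ∧ (IsSoficDeg σ P ↔ IsSoficDeg τ P) := by
  obtain ⟨m, t, ht⟩ := exists_transversal ι hι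
  let E : K × Fin m ≃ G := Equiv.ofBijective _ ht
  have hE : ∀ a i, E (a, i) = ι a * t i := fun _ _ => rfl
  refine ⟨⟨?_, ?_⟩, ⟨?_, ?_⟩⟩
  · rintro ⟨n, X, hX, hne, hP⟩
    have h := baireEquiv_preimage_unblock hE hσ hτ finFunctionFinEquiv.symm X
    exact ⟨_, _, hX.preimage_unblock hE _,
      nonempty_of_mSet_pullback (h.1.nonempty (nonempty_mSet_pullback hne)), h.trans hP⟩
  · rintro ⟨n, Y, hY, hne, hP⟩
    have h := baireEquiv_cosetwise hE hσ hτ fun y hy => hY.shift_mem hy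
    exact ⟨_, _, hY.cosetwise,
      nonempty_of_mSet_pullback (h.1.nonempty (nonempty_mSet_pullback hne)), h.trans hP⟩
  · rintro ⟨n, X, hX, hne, hP⟩
    have h := baireEquiv_preimage_unblock hE hσ hτ finFunctionFinEquiv.symm X
    exact ⟨_, _, hX.preimage_unblock hE _,
      nonempty_of_mSet_pullback (h.1.nonempty (nonempty_mSet_pullback hne)), h.trans hP⟩
  · rintro ⟨n, Y, hY, hne, hP⟩
    have h := baireEquiv_cosetwise hE hσ hτ fun y hy => hY.shift_mem hy
    exact ⟨_, _, hY.cosetwise hE,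
      nonempty_of_mSet_pullback (h.1.nonempty (nonempty_mSet_pullback hne)), h.trans hP⟩

end Degrees

theorem exists_fin_generators (G : Type*) [Group G] [hG : Group.FG G] :
    ∃ (k : ℕ) (σ : Fin k → G), Subgroup.closure (Set.range σ) = ⊤ := by
  obtain ⟨S, hS⟩ := hG.1
  refine ⟨S.card, fun i => (S.equivFin.symm i : G), ?_⟩
  rw [← hS]
  congr 1
  ext g
  exact ⟨fun ⟨i, hi⟩ => hi ▸ (S.equivFin.symm i).2,
    fun hg => ⟨S.equivFin ⟨g, hg⟩, by simp⟩⟩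

/-- If `G` and `H` are commensurable finitely generated groups, then
`M_SFT(G) = M_SFT(H)` and `M_sof(G) = M_sof(H)`. -/
theorem statement3 {G H : Type*} [Group G] [Group H] {k l : ℕ}
    (σ : Fin k → G) (hσ : IsSymmGen σ) (τ : Fin l → H) (hτ : IsSymmGen τ)
    (hcomm : ∃ (G' : Subgroup G) (H' : Subgroup H),
      G'.FiniteIndex ∧ H'.FiniteIndex ∧ Nonempty (↥G' ≃* ↥H')) :
    ∀ P : Set (ℕ → ℕ),
      (IsSFTDeg σ P ↔ IsSFTDeg τ P) ∧ (IsSoficDeg σ P ↔ IsSoficDeg τ P) := by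
  obtain ⟨G', H', hG', hH', ⟨e⟩⟩ := hcomm
  have : Group.FG G := ⟨⟨(Set.finite_range σ).toFinset, by simpa using hσ.1⟩⟩
  obtain ⟨n, ρ, hρ⟩ := exists_fin_generators G'
  have : G'.subtype.range.FiniteIndex := by rwa [Subgroup.range_subtype]
  have he : (H'.subtype.comp e.toMonoidHom).range = H' := by
    rw [MonoidHom.range_comp, MonoidHom.range_eq_top.2 e.surjective, ← MonoidHom.range_eq_map,
      Subgroup.range_subtype]
  have : (H'.subtype.comp e.toMonoidHom).range.FiniteIndex := by rwa [he]
  intro P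
  have h₁ := isSFTDeg_iff_and_isSoficDeg_iff G'.subtype G'.subtype_injective hσ.1 hρ P
  have h₂ := isSFTDeg_iff_and_isSoficDeg_iff (H'.subtype.comp e.toMonoidHom)
    (H'.subtype_injective.comp e.injective) hτ.1 hρ P
  exact ⟨h₁.1.trans h₂.1.symm, h₁.2.trans h₂.2.symm⟩

end MedvedevFormal
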